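/- arXiv:2509.12345 — 3 statements merged into one kernel-verified Lean document; each statement's English description precedes it below -/
import Mathlib

section
/- Let φ, w : ℂ∖{0} → ℂ be arbitrary functions and r,s ∈ ℤ. Then for every z ≠ 0: J_X(z;r,s)^{-1} = W · J_X(1/z; r,s) · W. (Part (a) of the symmetry theorem for the jump matrix.) -/
open Complex Matrix

noncomputable section

/-- The jump matrix `J_X(z; r, s)` of the X-Riemann-Hilbert problem. -/
def Jx (φ w : ℂ → ℂ) (r s : ℤ) (z : ℂ) : Matrix (Fin 4) (Fin 4) ℂ :=
  !![1, 0, z ^ (s - 1) * w z⁻¹, -(z ^ (1 - r)) * φ z;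
     0, 1, z ^ (r - 1) * φ z⁻¹, -(z ^ (1 - s)) * w z;
     0, 0, 1, 0;
     0, 0, 0, 1]

/-- The permutation matrix `W`. -/
def Wmat : Matrix (Fin 4) (Fin 4) ℂ :=
  !![0, 1, 0, 0;
     1, 0, 0, 0;
     0, 0, 0, 1;
     0, 0, 1, 0]

/-- Part (a) of the symmetry theorem: `J_X(z;r,s)⁻¹ = W · J_X(1/z;r,s) · W`. -/
theorem stmt3 (φ w : ℂ → ℂ) (r s : ℤ) (z : ℂ) (hz : z ≠ 0) :
    (Jx φ w r s z)⁻¹ = Wmat * Jx φ w r s z⁻¹ * Wmat := by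
  have h (n : ℤ) : z⁻¹ ^ n = z ^ (-n) := by rw [_root_.inv_zpow, _root_.zpow_neg]
  refine Matrix.inv_eq_right_inv ?_
  ext i j
  fin_cases i <;> fin_cases j <;>
    simp [Jx, Wmat, Matrix.mul_apply, Fin.sum_univ_four, h]
end
end

section
/- Let P, X°, X∞ ∈ M₄(ℂ) and set 𝒜 := P·X°, ℬ := X∞·P, 𝒟 := P − X∞·𝒜. Assume P₁₁ ≠ 0 and 𝒜₁₁ℬ₁₁/P₁₁ + 𝒟₁₁ ≠ 0, set α := (𝒜₁₁ℬ₁₁/P₁₁ + 𝒟₁₁)^{−1}, and for j,k ∈ {3,4} define ρ_j := 𝒜_{j1} − 𝒜₁₁P_{j1}/P₁₁, ν_j := ℬ₁₁P_{1j}/P₁₁ − ℬ_{1j}, ω_{jk} := P_{1j}P_{k1}/P₁₁, 𝓜_{jk} := −α·ρ_k·ν_j − ω_{jk} + P_{kj}, and Δ := 𝓜₃₄𝓜₄₃ − 𝓜₃₃𝓜₄₄. If Δ ≠ 0, then the 4×4 matrix [[P₁₁, −ℬ₁₁, P₃₁, P₄₁], [P₁₃, −ℬ₁₃, P₃₃,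 P₄₃], [P₁₄, −ℬ₁₄, P₃₄, P₄₄], [𝒜₁₁, 𝒟₁₁, 𝒜₃₁, 𝒜₄₁]] is invertible; in particular, for every right-hand side (x, y, w, z) ∈ ℂ⁴ the corresponding linear system has a unique solution. -/
open Complex Matrix

noncomputable section

/-- Cofactor form of a `4 × 4` determinant after eliminating with the pivots in positions `(0, 0)`
and `(3, 1)`; the remaining `2 × 2` factor is the iterated Schur complement. -/
theorem det_eq_pivots_mul_schur {K : Type*} [Field K]
    (p b₀ q₂ q₃ r₂ b₂ m₂₂ m₂₃ r₃ b₃ m₃₂ m₃₃ a₀ d a₂ a₃ : K)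
    (hp : p ≠ 0) (hs : a₀ * b₀ / p + d ≠ 0) :
    let α := (a₀ * b₀ / p + d)⁻¹
    let S : K → K → K → K → K → K := fun a q b r m =>
      -α * (a - a₀ * q / p) * (b₀ * r / p - b) - r * q / p + m
    Matrix.det !![p, -b₀, q₂, q₃; r₂, -b₂, m₂₂, m₂₃; r₃, -b₃, m₃₂, m₃₃; a₀, d, a₂, a₃] =
      -(p * (a₀ * b₀ / p + d) *
        (S a₃ q₃ b₂ r₂ m₂₃ * S a₂ q₂ b₃ r₃ m₃₂ - S a₂ q₂ b₂ r₂ m₂₂ * S a₃ q₃ b₃ r₃ m₃₃)) := by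
  intro α S
  have hα : (a₀ * b₀ / p + d) * α = 1 := mul_inv_cancel₀ hs
  have hd : d = (a₀ * b₀ / p + d) - a₀ * b₀ / p := by ring
  simp only [S]
  clear_value α
  generalize a₀ * b₀ / p + d = s at *
  subst hd
  obtain rfl : α = s⁻¹ := eq_inv_of_mul_eq_one_right hα
  simp [Matrix.det_succ_row_zero, Fin.sum_univ_succ, Fin.succAbove]
  field_simp
  ring

/-- Invertibility of the common coefficient matrix of the four linear systems arising in the
determination of the offset-(0,2) Riemann–Hilbert solution from the offset-(1,1) one. -/
theorem stmt12 (P Xo Xinf : Matrix (Fin 4) (Fin 4) ℂ) (hP11 : P 0 0 ≠ 0) :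
    let 𝒜 := P * Xo
    let ℬ := Xinf * P
    let 𝒟 := P - Xinf * 𝒜
    let α := (𝒜 0 0 * ℬ 0 0 / P 0 0 + 𝒟 0 0)⁻¹
    let ρ : Fin 4 → ℂ := fun j => 𝒜 j 0 - 𝒜 0 0 * P j 0 / P 0 0
    let ν : Fin 4 → ℂ := fun j => ℬ 0 0 * P 0 j / P 0 0 - ℬ 0 j
    let ω : Fin 4 → Fin 4 → ℂ := fun j k => P 0 j * P k 0 / P 0 0
    let 𝓜 : Fin 4 → Fin 4 → ℂ := fun j k => -α * ρ k * ν j - ω j k + P k j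
    let Δ := 𝓜 2 3 * 𝓜 3 2 - 𝓜 2 2 * 𝓜 3 3
    let N : Matrix (Fin 4) (Fin 4) ℂ :=
      !![P 0 0, -ℬ 0 0, P 2 0, P 3 0;
         P 0 2, -ℬ 0 2, P 2 2, P 3 2;
         P 0 3, -ℬ 0 3, P 2 3, P 3 3;
         𝒜 0 0, 𝒟 0 0, 𝒜 2 0, 𝒜 3 0]
    𝒜 0 0 * ℬ 0 0 / P 0 0 + 𝒟 0 0 ≠ 0 → Δ ≠ 0 →
    IsUnit N ∧ ∀ v : Fin 4 → ℂ, ∃! x : Fin 4 → ℂ, N.mulVec x = v := by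
  intro 𝒜 ℬ 𝒟 α ρ ν ω 𝓜 Δ N hs hΔ
  have hdet : N.det = -(P 0 0 * (𝒜 0 0 * ℬ 0 0 / P 0 0 + 𝒟 0 0) * Δ) :=
    det_eq_pivots_mul_schur _ _ _ _ _ _ _ _ _ _ _ _ _ _ _ _ hP11 hs
  have hN : IsUnit N := by
    rw [Matrix.isUnit_iff_isUnit_det, hdet, isUnit_iff_ne_zero]
    exact neg_ne_zero.mpr (mul_ne_zero (mul_ne_zero hP11 hs) hΔ)
  exact ⟨hN, (Function.bijective_iff_existsUnique _).mp
    ⟨Matrix.mulVec_injective_iff_isUnit.mpr hN, Matrix.mulVec_surjective_iff_isUnit.mpr hN⟩⟩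
end
end

section
/- Let Û be an invertible 4×4 complex matrix with (1 − Û₂₁)·Û₄₂ + Û₂₂·Û₄₁ ≠ 0. If C₁, C₂, C₃, C₄ ∈ ℂ satisfy the 2×4 matrix identity [[1, C₁, 0, C₃], [0, C₂, 1, C₄]] = [[C₁, 1, C₃, 0], [C₂, 0, C₄, 1]] · Û^{-1}, then necessarily C₂ = (Û₄₂Û₃₁ − Û₄₁Û₃₂)/((1−Û₂₁)Û₄₂ + Û₄₁Û₂₂) and C₄ = −(Û₂₂Û₃₁ + (1−Û₂₁)Û₃₂)/((1−Û₂₁)Û₄₂ + Û₄₁Û₂₂). -/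
open Complex Matrix

noncomputable section

/-- Determination of the constants `C₂, C₄` from the linear system
`(1, C₁, 0, C₃; 0, C₂, 1, C₄) = (C₁, 1, C₃, 0; C₂, 0, C₄, 1)·Û⁻¹`. -/
theorem stmt14 (U : Matrix (Fin 4) (Fin 4) ℂ) (hU : IsUnit U)
    (hden : (1 - U 1 0) * U 3 1 + U 1 1 * U 3 0 ≠ 0)
    (C1 C2 C3 C4 : ℂ)
    (hC : (!![1, C1, 0, C3; 0, C2, 1, C4] : Matrix (Fin 2) (Fin 4) ℂ) =
      (!![C1, 1, C3, 0; C2, 0, C4, 1] : Matrix (Fin 2) (Fin 4) ℂ) * U⁻¹) :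
    C2 = (U 3 1 * U 2 0 - U 3 0 * U 2 1) / ((1 - U 1 0) * U 3 1 + U 3 0 * U 1 1) ∧
    C4 = -((U 1 1 * U 2 0 + (1 - U 1 0) * U 2 1) /
      ((1 - U 1 0) * U 3 1 + U 3 0 * U 1 1)) := by
  have hUC := congrArg (· * U) hC
  simp only [Matrix.mul_assoc, Matrix.nonsing_inv_mul U ((Matrix.isUnit_iff_isUnit_det U).mp hU),
    Matrix.mul_one] at hUC
  have h0 := congrFun (congrFun hUC 1) 0
  have h1 := congrFun (congrFun hUC 1) 1
  simp [Matrix.mul_apply, Fin.sum_univ_four] at h0 h1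
  have hden' : (1 - U 1 0) * U 3 1 + U 3 0 * U 1 1 ≠ 0 := by
    rwa [mul_comm (U 3 0)]
  constructor
  · rw [eq_div_iff hden']
    linear_combination -U 3 1 * h0 + U 3 0 * h1
  · rw [← neg_div, eq_div_iff hden']
    linear_combination U 1 1 * h0 + (1 - U 1 0) * h1
end
end
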